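/- Let G be a graph containing no jewel, no pyramid and no hole of length five, let C be a shortest odd hole in G, and let x be a C-major vertex. Then there is an edge uv of C such that x is adjacent to at least one of u, v, and every C-major vertex nonadjacent to x is adjacent to at least one of u, v. -/

import Mathlib

/-!
Common definitions: holes, odd holes, C-major vertices, induced paths,
pyramids, jewels, candidates, x-gaps, gaps and normal sets.
A hole of length `n` is encoded as an injective map `f : ZMod n → V`
such that adjacency in `G` between vertices of the hole holds exactly
for consecutive indices (i.e. the hole is an induced cycle).
-/

variable {V : Type*}

/-- A hole: an induced cycle of length `n ≥ 4`. -/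
def IsHole (G : SimpleGraph V) (n : ℕ) (f : ZMod n → V) : Prop :=
  4 ≤ n ∧ Function.Injective f ∧
    ∀ i j : ZMod n, G.Adj (f i) (f j) ↔ (j = i + 1 ∨ i = j + 1)

/-- An odd hole. -/
def IsOddHole (G : SimpleGraph V) (n : ℕ) (f : ZMod n → V) : Prop :=
  IsHole G n f ∧ Odd n

/-- A shortest odd hole: an odd hole of minimum length among all odd holes. -/
def IsShortestOddHole (G : SimpleGraph V) (n : ℕ) (f : ZMod n → V) : Prop :=
  IsOddHole G n f ∧ ∀ (m : ℕ) (g : ZMod m → V), IsOddHole G m g → n ≤ m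

/-- `G` has an odd hole. -/
def HasOddHole (G : SimpleGraph V) : Prop :=
  ∃ (n : ℕ) (f : ZMod n → V), IsOddHole G n f

/-- A vertex `v` is `C`-major (for the hole given by `f`): `v` is not on the hole and
no three consecutive vertices of the hole contain all neighbours of `v` on the hole. -/
def IsCMajor (G : SimpleGraph V) {n : ℕ} (f : ZMod n → V) (v : V) : Prop :=
  v ∉ Set.range f ∧
    ∀ i : ZMod n, ∃ j : ZMod n, G.Adj v (f j) ∧ j ≠ i - 1 ∧ j ≠ i ∧ j ≠ i + 1

/-- An induced path of length `k`, encoded by its sequence of vertices: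
adjacency holds exactly between consecutive vertices. -/
def IsInducedPathMap (G : SimpleGraph V) (k : ℕ) (p : Fin (k + 1) → V) : Prop :=
  Function.Injective p ∧
    ∀ i j : Fin (k + 1), G.Adj (p i) (p j) ↔ (i.val + 1 = j.val ∨ j.val + 1 = i.val)

/-- A (not necessarily induced) path of length `k`, encoded by its sequence of vertices. -/
def IsPathMap (G : SimpleGraph V) (k : ℕ) (p : Fin (k + 1) → V) : Prop :=
  Function.Injective p ∧ ∀ i : Fin k, G.Adj (p i.castSucc) (p i.succ)

/-- A pyramid with apex `v0`, base `{v1, v2, v3}`, and paths `p1, p2, p3`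
(of lengths `k1, k2, k3`) from `v0` to `v1, v2, v3` respectively. -/
def IsPyramid (G : SimpleGraph V) (v0 v1 v2 v3 : V) (k1 k2 k3 : ℕ)
    (p1 : Fin (k1 + 1) → V) (p2 : Fin (k2 + 1) → V) (p3 : Fin (k3 + 1) → V) : Prop :=
  IsInducedPathMap G k1 p1 ∧ IsInducedPathMap G k2 p2 ∧ IsInducedPathMap G k3 p3 ∧
  p1 0 = v0 ∧ p2 0 = v0 ∧ p3 0 = v0 ∧
  p1 (Fin.last k1) = v1 ∧ p2 (Fin.last k2) = v2 ∧ p3 (Fin.last k3) = v3 ∧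
  v1 ≠ v0 ∧ v2 ≠ v0 ∧ v3 ≠ v0 ∧
  G.Adj v1 v2 ∧ G.Adj v1 v3 ∧ G.Adj v2 v3 ∧
  ((2 ≤ k1 ∧ 2 ≤ k2) ∨ (2 ≤ k1 ∧ 2 ≤ k3) ∨ (2 ≤ k2 ∧ 2 ≤ k3)) ∧
  (Set.range p1 ∩ Set.range p2 ⊆ {v0}) ∧
  (Set.range p1 ∩ Set.range p3 ⊆ {v0}) ∧
  (Set.range p2 ∩ Set.range p3 ⊆ {v0}) ∧
  (∀ u w : V, u ∈ Set.range p1 → w ∈ Set.range p2 → u ≠ v0 → w ≠ v0 →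
    G.Adj u w → u = v1 ∧ w = v2) ∧
  (∀ u w : V, u ∈ Set.range p1 → w ∈ Set.range p3 → u ≠ v0 → w ≠ v0 →
    G.Adj u w → u = v1 ∧ w = v3) ∧
  (∀ u w : V, u ∈ Set.range p2 → w ∈ Set.range p3 → u ≠ v0 → w ≠ v0 →
    G.Adj u w → u = v2 ∧ w = v3)

/-- `G` contains a pyramid. -/
def ContainsPyramid (G : SimpleGraph V) : Prop :=
  ∃ (v0 v1 v2 v3 : V) (k1 k2 k3 : ℕ) (p1 : Fin (k1 + 1) → V)
    (p2 : Fin (k2 + 1) → V) (p3 : Fin (k3 + 1) → V),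
    IsPyramid G v0 v1 v2 v3 k1 k2 k3 p1 p2 p3

/-- A jewel on vertices `v1, …, v5` together with the path `p` (of length `k`)
from `v1` to `v4`. -/
def IsJewel (G : SimpleGraph V) (v1 v2 v3 v4 v5 : V) (k : ℕ)
    (p : Fin (k + 1) → V) : Prop :=
  List.Pairwise Ne [v1, v2, v3, v4, v5] ∧
  G.Adj v1 v2 ∧ G.Adj v2 v3 ∧ G.Adj v3 v4 ∧ G.Adj v4 v5 ∧ G.Adj v5 v1 ∧
  ¬ G.Adj v1 v3 ∧ ¬ G.Adj v2 v4 ∧ ¬ G.Adj v1 v4 ∧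
  IsInducedPathMap G k p ∧ p 0 = v1 ∧ p (Fin.last k) = v4 ∧
  ∀ i : Fin (k + 1), i ≠ 0 → i ≠ Fin.last k →
    ¬ G.Adj v2 (p i) ∧ ¬ G.Adj v3 (p i) ∧ ¬ G.Adj v5 (p i)

/-- `G` contains a jewel. -/
def ContainsJewel (G : SimpleGraph V) : Prop :=
  ∃ (v1 v2 v3 v4 v5 : V) (k : ℕ) (p : Fin (k + 1) → V),
    IsJewel G v1 v2 v3 v4 v5 k p

/-- A candidate: a graph with no jewel, no pyramid, and no heavy-cleanable shortest
odd hole (a shortest odd hole is heavy-cleanable if some edge of it has the property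
that every major vertex is adjacent to one of its ends). -/
def Candidate (G : SimpleGraph V) : Prop :=
  ¬ ContainsJewel G ∧ ¬ ContainsPyramid G ∧
  ¬ ∃ (n : ℕ) (f : ZMod n → V) (i : ZMod n), IsShortestOddHole G n f ∧
      ∀ v : V, IsCMajor G f v → (G.Adj v (f i) ∨ G.Adj v (f (i + 1)))

/-- An `x`-gap of a hole `f : ZMod n → V`: an induced path of the hole, of length
`ℓ ≥ 2`, starting at index `a` and ending at index `a + ℓ`, whose ends are adjacent
to `x` and whose internal vertices are nonadjacent to `x`. (The condition `ℓ + 2 ≤ n`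
says that the arc is an induced path of the hole.) -/
def IsXGap (G : SimpleGraph V) {n : ℕ} (f : ZMod n → V) (x : V) (a : ZMod n)
    (ℓ : ℕ) : Prop :=
  2 ≤ ℓ ∧ ℓ + 2 ≤ n ∧ G.Adj x (f a) ∧ G.Adj x (f (a + (ℓ : ZMod n))) ∧
    ∀ t : ℕ, 0 < t → t < ℓ → ¬ G.Adj x (f (a + (t : ZMod n)))

/-- `ℓ` is the length of an `A`-gap of the cycle on `ZMod n` (with `A ⊆ ZMod n`):
either `A = ∅` and the gap is the whole cycle, or the gap runs from some `i ∈ A`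
to `i + ℓ ∈ A` with no internal vertex in `A`. -/
def IsGapLength (n : ℕ) (A : Set (ZMod n)) (ℓ : ℕ) : Prop :=
  (A = ∅ ∧ ℓ = n) ∨
  (2 ≤ ℓ ∧ ℓ ≤ n ∧ ∃ i ∈ A, (i + (ℓ : ZMod n)) ∈ A ∧
    ∀ t : ℕ, 0 < t → t < ℓ → (i + (t : ZMod n)) ∉ A)

/-- `A` is normal in the cycle on `ZMod n`: every `A`-gap has even length. -/
def NormalInCycle (n : ℕ) (A : Set (ZMod n)) : Prop :=
  ∀ ℓ : ℕ, IsGapLength n A ℓ → Even ℓ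

/-- `v 0, …, v (m - 1)` are distinct and adjacent exactly when cyclically consecutive. -/
def IsHoleSeq (G : SimpleGraph V) (m : ℕ) (v : ℕ → V) : Prop :=
  ∀ i j : ℕ, i < j → j < m →
    v i ≠ v j ∧ (G.Adj (v i) (v j) ↔ j = i + 1 ∨ (i = 0 ∧ j + 1 = m))

/-- `v 0, …, v k` are the vertices of an induced path, in order. -/
def IsPathSeq (G : SimpleGraph V) (k : ℕ) (v : ℕ → V) : Prop :=
  ∀ i j : ℕ, i < j → j ≤ k → v i ≠ v j ∧ (G.Adj (v i) (v j) ↔ j = i + 1)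

lemma IsHole.isHoleSeq {G : SimpleGraph V} {n : ℕ} {f : ZMod n → V} (hf : IsHole G n f) :
    IsHoleSeq G n (fun k => f (k : ZMod n)) := by
  obtain ⟨hn, hinj, hadj⟩ := hf
  have cast_eq : ∀ a b : ℕ, a ≤ n → b ≤ n →
      ((a : ZMod n) = (b : ZMod n) ↔ a = b ∨ (a = 0 ∧ b = n) ∨ (a = n ∧ b = 0)) := by
    intro a b ha hb
    rw [ZMod.natCast_eq_natCast_iff']
    rcases ha.lt_or_eq with ha | rfl <;> rcases hb.lt_or_eq with hb | rfl <;>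
      simp [Nat.mod_eq_of_lt, *] <;> omega
  intro i j hij hj
  refine ⟨fun h => ?_, ?_⟩
  · have := (cast_eq i j (by omega) (by omega)).1 (hinj h)
    omega
  · rw [hadj]
    have h₁ := cast_eq j (i + 1) (by omega) (by omega)
    have h₂ := cast_eq i (j + 1) (by omega) (by omega)
    push_cast at h₁ h₂
    rw [h₁, h₂]
    omega

lemma IsHoleSeq.exists_isHole {G : SimpleGraph V} {m : ℕ} {v : ℕ → V} (hm : 4 ≤ m)
    (hv : IsHoleSeq G m v) : ∃ g : ZMod m → V, IsHole G m g := by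
  obtain ⟨k, rfl⟩ : ∃ k, m = k + 1 := ⟨m - 1, by omega⟩
  have succ_iff : ∀ i j : ZMod (k + 1), j = i + 1 ↔
      j.val = i.val + 1 ∨ (j.val = 0 ∧ i.val = k) := by
    intro i j
    have hi := ZMod.val_lt i
    have hj := ZMod.val_lt j
    rw [← (ZMod.val_injective (k + 1)).eq_iff, ZMod.val_add, ZMod.val_one'' (by omega)]
    rcases (Nat.lt_succ_iff.1 hi).lt_or_eq with h | h
    · rw [Nat.mod_eq_of_lt (by omega)]; omega
    · rw [h, Nat.mod_self]; omega
  refine ⟨fun i => v i.val, hm, fun i j hij => ?_, fun i j => ?_⟩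
  · apply ZMod.val_injective (k + 1)
    by_contra hne
    rcases Nat.lt_or_gt_of_ne hne with h | h
    · exact (hv _ _ h (ZMod.val_lt j)).1 hij
    · exact (hv _ _ h (ZMod.val_lt i)).1 hij.symm
  · rw [succ_iff, succ_iff]
    have hi := ZMod.val_lt i
    have hj := ZMod.val_lt j
    rcases Nat.lt_trichotomy i.val j.val with h | h | h
    · rw [(hv _ _ h hj).2]; omega
    · simp only [h, SimpleGraph.irrefl, false_iff]; omega
    · rw [G.adj_comm, (hv _ _ h hi).2]; omega

lemma IsPathSeq.isInducedPathMap {G : SimpleGraph V} {k : ℕ} {v : ℕ → V}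
    (hv : IsPathSeq G k v) : IsInducedPathMap G k (fun i => v i.val) := by
  refine ⟨fun i j hij => ?_, fun i j => ?_⟩
  · by_contra hne
    rcases lt_or_gt_of_ne hne with h | h
    · exact (hv i.val j.val h (by omega)).1 hij
    · exact (hv j.val i.val h (by omega)).1 hij.symm
  · rcases Nat.lt_trichotomy i.val j.val with h | h | h
    · rw [(hv _ _ h (by omega)).2]; omega
    · simp only [h, SimpleGraph.irrefl, false_iff]; omega
    · rw [G.adj_comm, (hv _ _ h (by omega)).2]; omega

/-- A hole through `v 0`, together with a path from `v 0` to a vertex whose other neighbours on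
the hole are exactly the two ends of an edge, is a pyramid with apex `v 0`. -/
lemma containsPyramid_of_hole {G : SimpleGraph V} {m k i : ℕ} {v q : ℕ → V}
    (hv : IsHoleSeq G m v) (hq : IsPathSeq G k q) (h0 : q 0 = v 0)
    (hi : 1 ≤ i) (him : i + 2 ≤ m) (hk : 1 ≤ k)
    (hlen : (2 ≤ i ∧ i + 3 ≤ m) ∨ (2 ≤ k ∧ 4 ≤ m))
    (hqv : ∀ j l : ℕ, 1 ≤ j → j ≤ k → 1 ≤ l → l < m →
      q j ≠ v l ∧ (G.Adj (q j) (v l) ↔ j = k ∧ (l = i ∨ l = i + 1))) :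
    ContainsPyramid G := by
  have hp₁ : IsPathSeq G i v := fun a b hab hb =>
    ⟨(hv a b hab (by omega)).1, by rw [(hv a b hab (by omega)).2]; omega⟩
  let r : ℕ → V := fun j => if j = 0 then v 0 else v (m - j)
  have r0 : r 0 = v 0 := rfl
  have rs : ∀ j, 1 ≤ j → r j = v (m - j) := fun j hj => if_neg (by omega)
  have hp₂ : IsPathSeq G (m - 1 - i) r := by
    intro a b hab hb
    rcases Nat.eq_zero_or_pos a with rfl | ha
    · rw [r0, rs b (by omega)]
      have := hv 0 (m - b) (by omega) (by omega)
      exact ⟨this.1, by rw [this.2]; omega⟩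
    · rw [rs a ha, rs b (by omega)]
      have := hv (m - b) (m - a) (by omega) (by omega)
      exact ⟨this.1.symm, by rw [G.adj_comm, this.2]; omega⟩
  have hk₂ : r (m - 1 - i) = v (i + 1) := by
    rw [rs _ (by omega)]; congr 1; omega
  refine ⟨v 0, v i, v (i + 1), q k, i, m - 1 - i, k, _, _, _, hp₁.isInducedPathMap,
    hp₂.isInducedPathMap, hq.isInducedPathMap, rfl, rfl, h0, rfl, hk₂, rfl,
    (hv 0 i (by omega) (by omega)).1.symm, (hv 0 (i + 1) (by omega) (by omega)).1.symm,
    fun h => (hq 0 k (by omega) le_rfl).1 (h0.trans h.symm),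
    (hv i (i + 1) (by omega) (by omega)).2.2 (Or.inl rfl),
    ((hqv k i hk le_rfl hi (by omega)).2.2 ⟨rfl, Or.inl rfl⟩).symm,
    ((hqv k (i + 1) hk le_rfl (by omega) (by omega)).2.2 ⟨rfl, Or.inr rfl⟩).symm,
    by omega, ?_, ?_, ?_, ?_, ?_, ?_⟩
  · rintro _ ⟨⟨a, rfl⟩, ⟨b, hb⟩⟩
    rcases Nat.eq_zero_or_pos b.val with h | h
    · exact hb.symm.trans (by simp only [h, r0])
    · refine absurd hb.symm ?_
      simp only [rs _ h]
      exact (hv a.val (m - b.val) (by omega) (by omega)).1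
  · rintro _ ⟨⟨a, rfl⟩, ⟨b, hb⟩⟩
    rcases Nat.eq_zero_or_pos a.val with h | h
    · simp [h]
    rcases Nat.eq_zero_or_pos b.val with h' | h'
    · exact hb.symm.trans (by simp only [h', h0])
    · exact absurd hb (hqv b.val a.val h' (by omega) h (by omega)).1
  · rintro _ ⟨⟨a, rfl⟩, ⟨b, hb⟩⟩
    rcases Nat.eq_zero_or_pos a.val with h | h
    · simp [h, r0]
    rcases Nat.eq_zero_or_pos b.val with h' | h'
    · exact hb.symm.trans (by simp only [h', h0])
    · simp only [rs _ h] at hb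
      exact absurd hb (hqv b.val (m - a.val) h' (by omega) (by omega) (by omega)).1
  · rintro _ _ ⟨a, rfl⟩ ⟨b, rfl⟩ ha hb hab
    have ha' : a.val ≠ 0 := fun h => ha (by simp only [h])
    have hb' : b.val ≠ 0 := fun h => hb (by simp only [h, r0])
    simp only [rs _ (Nat.pos_of_ne_zero hb')] at hab ⊢
    rw [(hv _ _ (by omega) (by omega)).2] at hab
    exact ⟨congrArg v (by omega), congrArg v (by omega)⟩
  · rintro _ _ ⟨a, rfl⟩ ⟨b, rfl⟩ ha hb hab
    have ha' : a.val ≠ 0 := fun h => ha (by simp only [h])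
    have hb' : b.val ≠ 0 := fun h => hb (by simp only [h, h0])
    have := (hqv b.val a.val (by omega) (by omega) (by omega) (by omega)).2.1 hab.symm
    exact ⟨congrArg v (by omega), congrArg q this.1⟩
  · rintro _ _ ⟨a, rfl⟩ ⟨b, rfl⟩ ha hb hab
    have ha' : a.val ≠ 0 := fun h => ha (by simp only [h, r0])
    have hb' : b.val ≠ 0 := fun h => hb (by simp only [h, h0])
    simp only [rs _ (Nat.pos_of_ne_zero ha')] at hab ⊢
    have := (hqv b.val (m - a.val) (by omega) (by omega) (by omega) (by omega)).2.1 hab.symm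
    exact ⟨congrArg v (by omega), congrArg q this.1⟩

/-- The sequence `x, p 0, p 1, …`. -/
def consSeq (x : V) (p : ℕ → V) : ℕ → V
  | 0 => x
  | k + 1 => p k

/-- The sequence `p 0, …, p k, r 0, r 1, …`. -/
def appendSeq (k : ℕ) (p r : ℕ → V) (j : ℕ) : V :=
  if j ≤ k then p j else r (j - k - 1)

lemma IsPathSeq.cons {G : SimpleGraph V} {k : ℕ} {p : ℕ → V} {x : V} (hp : IsPathSeq G k p)
    (hx : ∀ j ≤ k, x ≠ p j ∧ (G.Adj x (p j) ↔ j = 0)) : IsPathSeq G (k + 1) (consSeq x p) := by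
  rintro (_ | i) (_ | j) hij hj
  · omega
  · obtain ⟨h₁, h₂⟩ := hx j (by omega)
    exact ⟨h₁, h₂.trans (by omega)⟩
  · omega
  · obtain ⟨h₁, h₂⟩ := hp i j (by omega) (by omega)
    exact ⟨h₁, h₂.trans (by omega)⟩

lemma IsPathSeq.isHoleSeq_cons {G : SimpleGraph V} {k : ℕ} {p : ℕ → V} {x : V}
    (hp : IsPathSeq G k p) (hx : ∀ j ≤ k, x ≠ p j ∧ (G.Adj x (p j) ↔ j = 0 ∨ j = k)) :
    IsHoleSeq G (k + 2) (consSeq x p) := by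
  rintro (_ | i) (_ | j) hij hj
  · omega
  · obtain ⟨h₁, h₂⟩ := hx j (by omega)
    exact ⟨h₁, h₂.trans (by omega)⟩
  · omega
  · obtain ⟨h₁, h₂⟩ := hp i j (by omega) (by omega)
    exact ⟨h₁, h₂.trans (by omega)⟩

lemma IsPathSeq.append {G : SimpleGraph V} {k l : ℕ} {p r : ℕ → V} (hp : IsPathSeq G k p)
    (hr : IsPathSeq G l r)
    (hpr : ∀ i j : ℕ, i ≤ k → j ≤ l → p i ≠ r j ∧ (G.Adj (p i) (r j) ↔ i = k ∧ j = 0)) :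
    IsPathSeq G (k + l + 1) (appendSeq k p r) := by
  intro i j hij hj
  unfold appendSeq
  by_cases hjk : j ≤ k
  · rw [if_pos hjk, if_pos (by omega)]
    exact hp i j hij hjk
  rw [if_neg hjk]
  by_cases hik : i ≤ k
  · rw [if_pos hik]
    obtain ⟨h₁, h₂⟩ := hpr i (j - k - 1) hik (by omega)
    exact ⟨h₁, h₂.trans (by omega)⟩
  · rw [if_neg hik]
    obtain ⟨h₁, h₂⟩ := hr (i - k - 1) (j - k - 1) (by omega) (by omega)
    exact ⟨h₁, h₂.trans (by omega)⟩

/-- Cyclic shifts and reflections of a hole, as maps of the index set. -/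
def IsDihedral {n : ℕ} (e : ZMod n → ZMod n) : Prop :=
  Function.Bijective e ∧ ∀ i j, (e j = e i + 1 ∨ e i = e j + 1) ↔ (j = i + 1 ∨ i = j + 1)

lemma isDihedral_add {n : ℕ} (c : ZMod n) : IsDihedral (fun i => c + i) :=
  ⟨(Equiv.addLeft c).bijective, fun i j => by simp only [add_assoc, add_right_inj]⟩

lemma isDihedral_sub {n : ℕ} (c : ZMod n) : IsDihedral (fun i => c - i) := by
  refine ⟨(Equiv.subLeft c).bijective, fun i j => ?_⟩
  have key : ∀ i j : ZMod n, c - j = c - i + 1 ↔ i = j + 1 := fun i j =>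
    ⟨fun h => by linear_combination h, fun h => by linear_combination h⟩
  rw [key i j, key j i, or_comm]

lemma IsShortestOddHole.comp {G : SimpleGraph V} {n : ℕ} {f : ZMod n → V}
    (hf : IsShortestOddHole G n f) {e : ZMod n → ZMod n} (he : IsDihedral e) :
    IsShortestOddHole G n (fun i => f (e i)) := by
  obtain ⟨⟨⟨hn, hinj, hadj⟩, hodd⟩, hmin⟩ := hf
  exact ⟨⟨⟨hn, hinj.comp he.1.1, fun i j => (hadj _ _).trans (he.2 i j)⟩, hodd⟩, hmin⟩

lemma IsCMajor.comp {G : SimpleGraph V} {n : ℕ} {f : ZMod n → V} {x : V}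
    (hx : IsCMajor G f x) {e : ZMod n → ZMod n} (he : IsDihedral e) :
    IsCMajor G (fun i => f (e i)) x := by
  refine ⟨fun ⟨i, hi⟩ => hx.1 ⟨e i, hi⟩, fun i => ?_⟩
  obtain ⟨j, hj, h₁, h₂, h₃⟩ := hx.2 (e i)
  obtain ⟨k, rfl⟩ := he.1.2 j
  refine ⟨k, hj, ?_, fun h => h₂ (by rw [h]), ?_⟩
  · intro h
    rcases (he.2 i k).2 (Or.inr (by rw [h]; ring)) with h | h
    · exact h₃ h
    · exact h₁ (by rw [h]; ring)
  · intro h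
    rcases (he.2 i k).2 (Or.inl h) with h | h
    · exact h₃ h
    · exact h₁ (by rw [h]; ring)

/-- `x` is adjacent to the `k`-th vertex of the hole `f`, counted cyclically. -/
def Hits (G : SimpleGraph V) {n : ℕ} (f : ZMod n → V) (x : V) (k : ℕ) : Prop :=
  G.Adj x (f (k : ZMod n))

lemma hits_add_length {G : SimpleGraph V} {n : ℕ} {f : ZMod n → V} {x : V} (k : ℕ) :
    Hits G f x (k + n) ↔ Hits G f x k := by
  simp [Hits]

lemma hits_comp_add {G : SimpleGraph V} {n : ℕ} {f : ZMod n → V} {x : V} (c k : ℕ) :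
    Hits G (fun i => f ((c : ZMod n) + i)) x k ↔ Hits G f x (c + k) := by
  simp [Hits]

lemma hits_comp_sub {G : SimpleGraph V} {n : ℕ} {f : ZMod n → V} {x : V} {c k : ℕ}
    (h : k ≤ c) : Hits G (fun i => f ((c : ZMod n) - i)) x k ↔ Hits G f x (c - k) := by
  simp [Hits, Nat.cast_sub h]

lemma IsHoleSeq.isPathSeq {G : SimpleGraph V} {n k c : ℕ} {v : ℕ → V} (hv : IsHoleSeq G n v)
    (hc : c + k < n) (hk : k + 2 ≤ n) : IsPathSeq G k (fun i => v (c + i)) := by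
  intro i j hij hj
  obtain ⟨h₁, h₂⟩ := hv (c + i) (c + j) (by omega) (by omega)
  exact ⟨h₁, h₂.trans (by omega)⟩

lemma IsHoleSeq.isPathSeq_sub {G : SimpleGraph V} {n k c : ℕ} {v : ℕ → V}
    (hv : IsHoleSeq G n v) (hc : c < n) (hkc : k ≤ c) (hk : k + 2 ≤ n) :
    IsPathSeq G k (fun i => v (c - i)) := by
  intro i j hij hj
  obtain ⟨h₁, h₂⟩ := hv (c - j) (c - i) (by omega) (by omega)
  exact ⟨h₁.symm, (G.adj_comm _ _).trans (h₂.trans (by omega))⟩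

/-- The neighbours of a major vertex are not contained in a three-vertex path of the hole. -/
lemma IsCMajor.exists_hits_three {G : SimpleGraph V} {n : ℕ} {f : ZMod n → V} {x : V}
    (hn : 4 ≤ n) (hx : IsCMajor G f x) : ∃ k, 3 ≤ k ∧ k < n ∧ Hits G f x k := by
  have : NeZero n := ⟨by omega⟩
  obtain ⟨j, hj, h₀, h₁, h₂⟩ := hx.2 1
  refine ⟨j.val, ?_, ZMod.val_lt j, by simpa [Hits] using hj⟩
  by_contra hlt
  have hcast : ((j.val : ℕ) : ZMod n) = j := ZMod.natCast_zmod_val j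
  have : j.val = 0 ∨ j.val = 1 ∨ j.val = 2 := by omega
  rcases this with h | h | h <;> rw [h] at hcast
  · exact h₀ (by rw [← hcast]; simp)
  · exact h₁ (by rw [← hcast]; simp)
  · exact h₂ (by rw [← hcast]; norm_num)

/-- Without jewels, the neighbours of a major vertex are not contained in a four-vertex path. -/
lemma IsCMajor.exists_hits_four_aux {G : SimpleGraph V} {n : ℕ} {f : ZMod n → V} {x : V}
    (hJ : ¬ ContainsJewel G) (hf : IsHole G n f) (hn : 5 ≤ n) (hx : IsCMajor G f x) :
    ∃ k, 4 ≤ k ∧ k < n ∧ Hits G f x k := by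
  by_contra! hcon
  have hv := hf.isHoleSeq
  have h3 : Hits G f x 3 := by
    obtain ⟨k, hk, hkn, h⟩ := hx.exists_hits_three (by omega)
    rcases hk.lt_or_eq with hk | rfl
    · exact absurd h (hcon k hk hkn)
    · exact h
  have h0 : Hits G f x 0 := by
    obtain ⟨k, hk, hkn, h⟩ :=
      (hx.comp (isDihedral_add ((1 : ℕ) : ZMod n))).exists_hits_three (by omega)
    rw [hits_comp_add] at h
    rcases (show 1 + k ≤ n by omega).lt_or_eq with hk' | hk'
    · exact absurd h (hcon _ (by omega) hk')
    · rw [hk'] at h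
      rw [← hits_add_length, zero_add]; exact h
  set v : ℕ → V := fun k => f (k : ZMod n) with hvdef
  have hxv : ∀ k, x ≠ v k := fun k h => hx.1 ⟨_, h.symm⟩
  have adj : ∀ k, k < n → G.Adj x (v k) → k < 4 := fun k hk h => by
    by_contra hlt; exact hcon k (by omega) hk h
  let p : ℕ → V := consSeq (v 0) (fun j => v (n - 1 - j))
  have hp : IsPathSeq G (n - 3) p := by
    have := (hv.isPathSeq_sub (c := n - 1) (k := n - 4) (by omega) (by omega) (by omega)).cons
      (x := v 0) (fun j hj => by
        obtain ⟨h₁, h₂⟩ := hv 0 (n - 1 - j) (by omega) (by omega)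
        exact ⟨h₁, h₂.trans (by omega)⟩)
    rwa [show n - 4 + 1 = n - 3 by omega] at this
  have hlast : p (n - 3) = v 3 := by
    rw [show n - 3 = (n - 4) + 1 by omega]
    change v (n - 1 - (n - 4)) = v 3
    congr 1; omega
  refine hJ ⟨v 0, v 1, v 2, v 3, x, n - 3, _, ?_, (hv 0 1 (by omega) (by omega)).2.2 (by omega),
    (hv 1 2 (by omega) (by omega)).2.2 (by omega), (hv 2 3 (by omega) (by omega)).2.2 (by omega),
    h3.symm, h0, fun h => ?_, fun h => ?_, fun h => ?_, hp.isInducedPathMap, rfl, hlast, ?_⟩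
  · have := hv 0 1 (by omega) (by omega)
    have := hv 0 2 (by omega) (by omega)
    have := hv 0 3 (by omega) (by omega)
    have := hv 1 2 (by omega) (by omega)
    have := hv 1 3 (by omega) (by omega)
    have := hv 2 3 (by omega) (by omega)
    have := hxv 0
    have := hxv 1
    have := hxv 2
    have := hxv 3
    simp only [List.pairwise_cons, List.mem_cons, List.not_mem_nil, or_false]
    grind
  · have := (hv 0 2 (by omega) (by omega)).2.1 h; omega
  · have := (hv 1 3 (by omega) (by omega)).2.1 h; omega
  · have := (hv 0 3 (by omega) (by omega)).2.1 h; omega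
  · rintro ⟨i, hi⟩ hi0 hil
    have hi0' : i ≠ 0 := fun h => hi0 (Fin.ext h)
    have hil' : i ≠ n - 3 := fun h => hil (Fin.ext h)
    obtain ⟨j, rfl⟩ : ∃ j, i = j + 1 := ⟨i - 1, by omega⟩
    change ¬ G.Adj (v 1) (v (n - 1 - j)) ∧ ¬ G.Adj (v 2) (v (n - 1 - j)) ∧
      ¬ G.Adj x (v (n - 1 - j))
    rw [(hv 1 (n - 1 - j) (by omega) (by omega)).2, (hv 2 (n - 1 - j) (by omega) (by omega)).2]
    exact ⟨by omega, by omega, fun h => by have := adj _ (by omega) h; omega⟩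

/-- `f` is a shortest odd hole of a graph with no jewel and no pyramid. -/
structure IsShortestOddHoleJP (G : SimpleGraph V) (n : ℕ) (f : ZMod n → V) : Prop where
  shortest : IsShortestOddHole G n f
  noJewel : ¬ ContainsJewel G
  noPyramid : ¬ ContainsPyramid G

namespace IsShortestOddHoleJP

variable {G : SimpleGraph V} {n : ℕ} {f : ZMod n → V} {x y : V}

lemma isHole (H : IsShortestOddHoleJP G n f) : IsHole G n f := H.shortest.1.1

lemma odd (H : IsShortestOddHoleJP G n f) : Odd n := H.shortest.1.2

lemma five_le (H : IsShortestOddHoleJP G n f) : 5 ≤ n := by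
  have := H.isHole.1
  obtain ⟨k, hk⟩ := H.odd
  omega

lemma comp (H : IsShortestOddHoleJP G n f) {e : ZMod n → ZMod n} (he : IsDihedral e) :
    IsShortestOddHoleJP G n (fun i => f (e i)) :=
  ⟨H.shortest.comp he, H.noJewel, H.noPyramid⟩

lemma not_odd_of_isHoleSeq (H : IsShortestOddHoleJP G n f) {m : ℕ} {v : ℕ → V} (hm : 4 ≤ m)
    (hmn : m < n) (hv : IsHoleSeq G m v) : ¬ Odd m := by
  intro hodd
  obtain ⟨g, hg⟩ := hv.exists_isHole hm
  have := H.shortest.2 m g ⟨hg, hodd⟩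
  omega

lemma exists_hits_four (H : IsShortestOddHoleJP G n f) (hx : IsCMajor G f x) (c : ℕ) :
    ∃ k, c + 4 ≤ k ∧ k < c + n ∧ Hits G f x k := by
  have he := isDihedral_add (c : ZMod n)
  obtain ⟨k, hk, hkn, h⟩ :=
    (hx.comp he).exists_hits_four_aux H.noJewel (H.comp he).isHole H.five_le
  exact ⟨c + k, by omega, by omega, (hits_comp_add c k).1 h⟩

/-- The gaps of a major vertex are even, and miss at least three edges of the hole. -/
lemma even_gap (H : IsShortestOddHoleJP G n f) (hx : IsCMajor G f x) {p l : ℕ} (hl : 2 ≤ l)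
    (hp : Hits G f x p) (hpl : Hits G f x (p + l))
    (hgap : ∀ k, p < k → k < p + l → ¬ Hits G f x k) : l + 3 ≤ n ∧ Even l := by
  have hln : l + 3 ≤ n := by
    obtain ⟨k, hk, hkn, h⟩ := H.exists_hits_four hx (p + n - 3)
    by_contra hlt
    have h5 := H.five_le
    have hk' : Hits G f x (k - n) := by
      rw [← hits_add_length, Nat.sub_add_cancel (by omega)]; exact h
    exact hgap (k - n) (by omega) (by omega) hk'
  refine ⟨hln, ?_⟩
  by_contra hodd
  have he := isDihedral_add (p : ZMod n)
  have hv := (H.comp he).isHole.isHoleSeq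
  have hmaj := hx.comp he
  have hhole := (hv.isPathSeq (c := 0) (k := l) (by omega) (by omega)).isHoleSeq_cons (x := x)
    (fun j hj => ⟨fun h => hmaj.1 ⟨_, h.symm⟩, by
      have hiff : Hits G f x (p + j) ↔ j = 0 ∨ j = l := by
        constructor
        · intro h
          by_contra hne
          exact hgap _ (by omega) (by omega) h
        · rintro (rfl | rfl) <;> assumption
      rw [← hiff, ← hits_comp_add, zero_add]
      rfl⟩)
  refine H.not_odd_of_isHoleSeq (by omega) (by omega) hhole ?_
  rw [Nat.not_even_iff_odd] at hodd
  exact hodd.add_even (by decide)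

/-- The neighbours of a major vertex are not just an edge of the hole and one further vertex. -/
lemma not_three_hits (H : IsShortestOddHoleJP G n f) (hx : IsCMajor G f x) {c i : ℕ}
    (hi : 2 ≤ i) (hin : i + 3 ≤ n)
    (h : ∀ k, c ≤ k → k < c + n → (Hits G f x k ↔ k = c ∨ k = c + i ∨ k = c + i + 1)) :
    False := by
  have he := isDihedral_add (c : ZMod n)
  have hmaj := hx.comp he
  have hv := (H.comp he).isHole.isHoleSeq
  set v : ℕ → V := fun k => f ((c : ZMod n) + k) with hvdef
  have hadj : ∀ k, k < n → (G.Adj x (v k) ↔ k = 0 ∨ k = i ∨ k = i + 1) := by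
    intro k hk
    have h' := h (c + k) (by omega) (by omega)
    rw [← hits_comp_add] at h'
    exact h'.trans (by omega)
  have hxv : ∀ k, x ≠ v k := fun k h => hmaj.1 ⟨_, h.symm⟩
  refine H.noPyramid (containsPyramid_of_hole (m := n) (k := 1) (i := i) (v := v)
    (q := consSeq (v 0) (fun _ => x)) hv ?_ rfl (by omega) (by omega) le_rfl
    (Or.inl ⟨hi, hin⟩) ?_)
  · rintro a b hab hb
    obtain rfl : b = 1 := by omega
    obtain rfl : a = 0 := by omega
    exact ⟨(hxv 0).symm, iff_of_true ((hadj 0 (by omega)).2 (by omega)).symm rfl⟩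
  · intro j l hj hj1 hl hln
    obtain rfl : j = 1 := by omega
    exact ⟨hxv l, (hadj l hln).trans (by omega)⟩

/-- A shortest interval between a point of `A` and a point of `B`. -/
lemma exists_closest_pair {A B : ℕ → Prop} {lo hi : ℕ} (d : ℕ) :
    ∀ a b : ℕ, a - b + (b - a) ≤ d → lo ≤ a → a ≤ hi → A a → lo ≤ b → b ≤ hi → B b →
    ∃ u z : ℕ, lo ≤ u ∧ u ≤ hi ∧ lo ≤ z ∧ z ≤ hi ∧ B u ∧ A z ∧
      ∀ k, (u ≤ k ∧ k ≤ z ∨ z ≤ k ∧ k ≤ u) → (B k → k = u) ∧ (A k → k = z) := by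
  induction d with
  | zero =>
    intro a b hd ha ha' hA hb hb' hB
    exact ⟨b, a, hb, hb', ha, ha', hB, hA, fun k hk => ⟨fun _ => by omega, fun _ => by omega⟩⟩
  | succ d ih =>
    intro a b hd ha ha' hA hb hb' hB
    by_cases hcon : ∀ k, (b ≤ k ∧ k ≤ a ∨ a ≤ k ∧ k ≤ b) → (B k → k = b) ∧ (A k → k = a)
    · exact ⟨b, a, hb, hb', ha, ha', hB, hA, hcon⟩
    · push Not at hcon
      obtain ⟨k, hk, h⟩ := hcon
      by_cases hBk : B k ∧ k ≠ b
      · exact ih a k (by omega) ha ha' hA (by omega) (by omega) hBk.1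
      · obtain ⟨hAk, hka⟩ := h (fun hB' => by by_contra hne; exact hBk ⟨hB', hne⟩)
        exact ih k b (by omega) (by omega) (by omega) hAk hb hb' hB

/-- If the only neighbours of `x` in a gap of `y` are the ends of an edge, then one of `x`, `y`
has no neighbours far from this gap. -/
lemma not_hits_both (H : IsShortestOddHoleJP G n f) (hx : IsCMajor G f x)
    (hy : IsCMajor G f y) (hne : x ≠ y) (hxy : ¬ G.Adj x y) {s L : ℕ} (hL : 2 ≤ L)
    (hLn : L + 3 ≤ n) (hsL : s + 1 ≤ L)
    (hyL : ∀ k ≤ L, (Hits G f y k ↔ k = 0 ∨ k = L))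
    (hxL : ∀ k ≤ L, (Hits G f x k ↔ k = s ∨ k = s + 1)) {a b : ℕ}
    (ha : L + 2 ≤ a) (han : a + 2 ≤ n) (hxa : Hits G f x a)
    (hb : L + 2 ≤ b) (hbn : b + 2 ≤ n) (hyb : Hits G f y b) : False := by
  have hv := H.isHole.isHoleSeq
  obtain ⟨u, z, hu, hu', hz, hz', hyu, hxz, huz⟩ := exists_closest_pair (A := Hits G f x)
    (B := Hits G f y) (lo := L + 2) (hi := n - 2) _ a b le_rfl ha (by omega) hxa hb (by omega) hyb
  have hxv : ∀ k : ZMod n, x ≠ f k := fun k h => hx.1 ⟨_, h.symm⟩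
  have hyv : ∀ k : ZMod n, y ≠ f k := fun k h => hy.1 ⟨_, h.symm⟩
  -- the vertices of the segment from `u` to `z`, in this order
  obtain ⟨d, σ, hσ, hσv, hyσ, hxσ⟩ : ∃ (d : ℕ) (σ : ℕ → ℕ),
      IsPathSeq G d (fun i => f (σ i : ZMod n)) ∧ (∀ i ≤ d, L + 2 ≤ σ i ∧ σ i + 2 ≤ n) ∧
      (∀ i ≤ d, Hits G f y (σ i) ↔ i = 0) ∧ (∀ i ≤ d, Hits G f x (σ i) ↔ i = d) := by
    rcases le_total u z with h | h
    · refine ⟨z - u, fun i => u + i, hv.isPathSeq (by omega) (by omega),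
        fun i hi => by dsimp only; omega, fun i hi => ⟨fun h' => ?_, fun h' => ?_⟩,
        fun i hi => ⟨fun h' => ?_, fun h' => ?_⟩⟩
      · have := (huz (u + i) (by omega)).1 h'; omega
      · subst h'; exact hyu
      · have := (huz (u + i) (by omega)).2 h'; omega
      · subst h'; dsimp only; rwa [show u + (z - u) = z by omega]
    · refine ⟨u - z, fun i => u - i, hv.isPathSeq_sub (by omega) (by omega) (by omega),
        fun i hi => by dsimp only; omega, fun i hi => ⟨fun h' => ?_, fun h' => ?_⟩,
        fun i hi => ⟨fun h' => ?_, fun h' => ?_⟩⟩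
      · have := (huz (u - i) (by omega)).1 h'; omega
      · subst h'; exact hyu
      · have := (huz (u - i) (by omega)).2 h'; omega
      · subst h'; dsimp only; rwa [show u - (u - z) = z by omega]
  have hhole : IsHoleSeq G (L + 2) (consSeq y (fun i => f ((0 + i : ℕ) : ZMod n))) :=
    (hv.isPathSeq (c := 0) (k := L) (by omega) (by omega)).isHoleSeq_cons (fun j hj =>
      ⟨hyv _, by rw [zero_add]; exact hyL j hj⟩)
  have hpath : IsPathSeq G (d + 2)
      (consSeq y (appendSeq d (fun i => f (σ i : ZMod n)) (fun _ => x))) := by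
    refine (hσ.append (l := 0) (r := fun _ => x) (fun i j hij hj => by omega)
      (fun i j hi hj => ⟨(hxv _).symm, ?_⟩)).cons (fun j hj => ?_)
    · rw [G.adj_comm]
      exact (hxσ i hi).trans (by omega)
    · by_cases hjd : j ≤ d
      · simp only [appendSeq, if_pos hjd]
        exact ⟨hyv _, hyσ j hjd⟩
      · simp only [appendSeq, if_neg hjd]
        exact ⟨hne.symm, iff_of_false (fun h => hxy h.symm) (by omega)⟩
  refine H.noPyramid (containsPyramid_of_hole (i := s + 1) hhole hpath rfl (by omega) (by omega)
    (by omega) (Or.inr (by omega)) ?_)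
  rintro (_ | j) (_ | l) hj hj' hl hl'
  · omega
  · omega
  · omega
  · simp only [consSeq, zero_add]
    by_cases hjd : j ≤ d
    · simp only [appendSeq, if_pos hjd]
      have hr := hσv j hjd
      obtain ⟨h₁, h₂⟩ := hv l (σ j) (by omega) (by omega)
      refine ⟨h₁.symm, iff_of_false (fun h => ?_) (by omega)⟩
      have := h₂.1 h.symm
      omega
    · simp only [appendSeq, if_neg hjd]
      exact ⟨hxv _, (hxL l (by omega)).trans (by omega)⟩

/-- The neighbours of `x` in a gap of `y` closest to the two ends cannot be at an even distance
from the first end and at an odd distance from the second. -/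
lemma not_even_odd (H : IsShortestOddHoleJP G n f) (hx : IsCMajor G f x)
    (hy : IsCMajor G f y) (hne : x ≠ y) (hxy : ¬ G.Adj x y) {s t L : ℕ} (hL : 2 ≤ L)
    (hLn : L + 3 ≤ n) (hLe : Even L) (hst : s ≤ t) (htL : t ≤ L)
    (hyL : ∀ k ≤ L, (Hits G f y k ↔ k = 0 ∨ k = L))
    (hxs : Hits G f x s) (hxt : Hits G f x t) (hxs' : ∀ k < s, ¬ Hits G f x k)
    (hxt' : ∀ k, t < k → k ≤ L → ¬ Hits G f x k) (hse : Even s) (hto : ¬ Even t) : False := by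
  have hv := H.isHole.isHoleSeq
  have hxv : ∀ k : ZMod n, x ≠ f k := fun k h => hx.1 ⟨_, h.symm⟩
  have hyv : ∀ k : ZMod n, y ≠ f k := fun k h => hy.1 ⟨_, h.symm⟩
  have hodd := H.odd
  rw [Nat.even_iff] at hLe hse hto
  rw [Nat.odd_iff] at hodd
  have hts : t = s + 1 := by
    by_contra hts
    have hpath := (hv.isPathSeq (c := t) (k := L - t) (by omega) (by omega)).append
      ((hv.isPathSeq (c := 0) (k := s) (by omega) (by omega)).cons (x := y) (fun j hj =>
        ⟨hyv _, by rw [zero_add]; exact (hyL j (by omega)).trans (by omega)⟩))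
      (fun i j hi hj => by
        rcases j with _ | j
        · refine ⟨(hyv _).symm, ?_⟩
          rw [G.adj_comm]
          exact (hyL (t + i) (by omega)).trans (by omega)
        · obtain ⟨h₁, h₂⟩ := hv j (t + i) (by omega) (by omega)
          simp only [consSeq, zero_add]
          refine ⟨h₁.symm, iff_of_false (fun h => ?_) (by omega)⟩
          have := h₂.1 h.symm
          omega)
    have hhole := hpath.isHoleSeq_cons (x := x) (fun j hj => by
      by_cases hjt : j ≤ L - t
      · simp only [appendSeq, if_pos hjt]
        refine ⟨hxv _, fun h => ?_, fun h => ?_⟩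
        · by_contra hj0
          exact hxt' (t + j) (by omega) (by omega) h
        · obtain rfl : j = 0 := by omega
          exact hxt
      · simp only [appendSeq, if_neg hjt]
        rcases hj' : j - (L - t) - 1 with _ | i
        · exact ⟨hne, iff_of_false hxy (by omega)⟩
        · simp only [consSeq, zero_add]
          refine ⟨hxv _, fun h => ?_, fun h => ?_⟩
          · by_contra hj0
            exact hxs' i (by omega) h
          · obtain rfl : i = s := by omega
            exact hxs)
    refine H.not_odd_of_isHoleSeq (by omega) (by omega) hhole ?_
    rw [Nat.odd_iff]
    omega
  subst hts
  have hxL : ∀ k ≤ L, (Hits G f x k ↔ k = s ∨ k = s + 1) := by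
    refine fun k hk => ⟨fun h => ?_, ?_⟩
    · by_contra hk'
      rcases Nat.lt_or_ge k s with h' | h'
      · exact hxs' k h' h
      · exact hxt' k (by omega) hk h
    · rintro (rfl | rfl) <;> assumption
  have per : ∀ {w : V} (k : ℕ), n ≤ k → (Hits G f w k ↔ Hits G f w (k - n)) := fun k hk => by
    rw [← hits_add_length (k - n), Nat.sub_add_cancel hk]
  by_cases hfar : ∃ a, L + 2 ≤ a ∧ a + 2 ≤ n ∧ Hits G f x a
  · obtain ⟨a, ha, han, hxa⟩ := hfar
    have hyfar : ∀ b, L + 2 ≤ b → b + 2 ≤ n → ¬ Hits G f y b := fun b hb hbn hyb =>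
      H.not_hits_both hx hy hne hxy hL hLn (by omega) hyL hxL ha han hxa hb hbn hyb
    have hy0 : Hits G f y 0 := (hyL 0 (by omega)).2 (by omega)
    have hyn : Hits G f y n := by rw [per n le_rfl, Nat.sub_self]; exact hy0
    have hyLL : Hits G f y L := (hyL L le_rfl).2 (by omega)
    by_cases h₁ : Hits G f y (L + 1) <;> by_cases h₂ : Hits G f y (n - 1)
    · by_cases hadj : L + 3 = n
      · obtain ⟨k, hk, hk', h⟩ := H.exists_hits_four hy L
        rw [per k (by omega), hyL _ (by omega)] at h
        omega
      · have := (H.even_gap hy (p := L + 1) (l := n - 2 - L) (by omega) h₁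
          (by rwa [show L + 1 + (n - 2 - L) = n - 1 by omega])
          (fun k hk hk' => hyfar k (by omega) (by omega))).2
        rw [Nat.even_iff] at this
        omega
    · refine H.not_three_hits hy (c := 0) (i := L) hL (by omega) (fun k hk hk' => ?_)
      by_cases hkL : k ≤ L
      · rw [hyL k hkL]; omega
      refine ⟨fun h => ?_, fun h => ?_⟩
      · by_contra hcon
        by_cases hkn : k = n - 1
        · exact h₂ (hkn ▸ h)
        · exact hyfar k (by omega) (by omega) h
      · rwa [show k = L + 1 by omega]
    · refine H.not_three_hits hy (c := L) (i := n - 1 - L) (by omega) (by omega)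
        (fun k hk hk' => ?_)
      by_cases hkn : n ≤ k
      · rw [per k hkn, hyL _ (by omega)]; omega
      refine ⟨fun h => ?_, fun h => ?_⟩
      · by_contra hcon
        by_cases hkL : k = L + 1
        · exact h₁ (hkL ▸ h)
        · exact hyfar k (by omega) (by omega) h
      · rcases (show k = L ∨ k = n - 1 by omega) with rfl | rfl <;> assumption
    · have := (H.even_gap hy (p := L) (l := n - L) (by omega) hyLL
        (by rwa [show L + (n - L) = n by omega])
        (fun k hk hk' h => by
          by_cases hkn : k = n - 1
          · exact h₂ (hkn ▸ h)
          by_cases hkL : k = L + 1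
          · exact h₁ (hkL ▸ h)
          exact hyfar k (by omega) (by omega) h)).2
      rw [Nat.even_iff] at this
      omega
  · push Not at hfar
    by_cases h₁ : Hits G f x (L + 1) <;> by_cases h₂ : Hits G f x (n - 1)
    · have hadj : L + 3 = n := by
        by_contra hadj
        have := (H.even_gap hx (p := L + 1) (l := n - 2 - L) (by omega) h₁
          (by rwa [show L + 1 + (n - 2 - L) = n - 1 by omega])
          (fun k hk hk' => hfar k (by omega) (by omega))).2
        rw [Nat.even_iff] at this
        omega
      rcases Nat.eq_zero_or_pos s with rfl | hs
      · obtain ⟨k, hk, hk', h⟩ := H.exists_hits_four hx (L + 1)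
        rw [per k (by omega), hxL _ (by omega)] at h
        omega
      · have := (H.even_gap hx (p := n - 1) (l := s + 1) (by omega) h₂
          (by rw [per _ (by omega), hxL _ (by omega)]; omega)
          (fun k hk hk' => by rw [per _ (by omega), hxL _ (by omega)]; omega)).2
        rw [Nat.even_iff] at this
        omega
    · refine H.not_three_hits hx (c := L + 1) (i := n + s - (L + 1)) (by omega) (by omega)
        (fun k hk hk' => ?_)
      by_cases hkn : n ≤ k
      · rw [per k hkn, hxL _ (by omega)]; omega
      refine ⟨fun h => ?_, fun h => ?_⟩
      · by_contra hcon
        by_cases hkL : k = n - 1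
        · exact h₂ (hkL ▸ h)
        · exact hfar k (by omega) (by omega) h
      · rwa [show k = L + 1 by omega]
    · rcases Nat.eq_zero_or_pos s with rfl | hs
      · obtain ⟨k, hk, hk', h⟩ := H.exists_hits_four hx (n - 2)
        by_cases hkL : k - n ≤ L
        · rw [per k (by omega), hxL _ (by omega)] at h
          omega
        · rw [per k (by omega)] at h
          by_cases hk1 : k - n = L + 1
          · exact h₁ (hk1 ▸ h)
          · exact hfar (k - n) (by omega) (by omega) h
      · have := (H.even_gap hx (p := n - 1) (l := s + 1) (by omega) h₂
          (by rw [per _ (by omega), hxL _ (by omega)]; omega)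
          (fun k hk hk' => by rw [per _ (by omega), hxL _ (by omega)]; omega)).2
        rw [Nat.even_iff] at this
        omega
    · obtain ⟨k, hk, hk', h⟩ := H.exists_hits_four hx s
      by_cases hkL : k ≤ L
      · rw [hxL _ (by omega)] at h
        omega
      by_cases hk1 : k = L + 1
      · exact h₁ (hk1 ▸ h)
      by_cases hkn : n ≤ k
      · rw [per k hkn, hxL _ (by omega)] at h
        omega
      by_cases hk2 : k = n - 1
      · exact h₂ (hk2 ▸ h)
      exact hfar k (by omega) (by omega) h

/-- In a gap of `y`, the first and last neighbours of `x` are at even distance. -/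
lemma even_span (H : IsShortestOddHoleJP G n f) (hx : IsCMajor G f x) (hy : IsCMajor G f y)
    (hne : x ≠ y) (hxy : ¬ G.Adj x y) {p L s t : ℕ} (hL : 2 ≤ L) (hp : Hits G f y p)
    (hpL : Hits G f y (p + L)) (hgap : ∀ k, p < k → k < p + L → ¬ Hits G f y k)
    (hps : p ≤ s) (hst : s ≤ t) (htL : t ≤ p + L) (hxs : Hits G f x s) (hxt : Hits G f x t)
    (hxs' : ∀ k, p ≤ k → k < s → ¬ Hits G f x k)
    (hxt' : ∀ k, t < k → k ≤ p + L → ¬ Hits G f x k) : Even (t - s) := by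
  obtain ⟨hLn, hLe⟩ := H.even_gap hy hL hp hpL hgap
  have hyL : ∀ k, p ≤ k → k ≤ p + L → (Hits G f y k ↔ k = p ∨ k = p + L) := by
    refine fun k hk hk' => ⟨fun h => ?_, ?_⟩
    · by_contra hcon
      exact hgap k (by omega) (by omega) h
    · rintro (rfl | rfl) <;> assumption
  by_contra hodd
  by_cases hse : Even (s - p)
  · have he := isDihedral_add (p : ZMod n)
    refine (H.comp he).not_even_odd (hx.comp he) (hy.comp he) hne hxy (s := s - p) (t := t - p)
      hL hLn hLe (by omega) (by omega) (fun k hk => ?_) ?_ ?_ (fun k hk => ?_)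
      (fun k hk hk' => ?_) hse ?_
    · rw [hits_comp_add, hyL _ (by omega) (by omega)]; omega
    · rw [hits_comp_add]; rwa [show p + (s - p) = s by omega]
    · rw [hits_comp_add]; rwa [show p + (t - p) = t by omega]
    · rw [hits_comp_add]; exact hxs' _ (by omega) (by omega)
    · rw [hits_comp_add]; exact hxt' _ (by omega) (by omega)
    · rw [Nat.even_iff] at *; omega
  · have he := isDihedral_sub ((p + L : ℕ) : ZMod n)
    refine (H.comp he).not_even_odd (hx.comp he) (hy.comp he) hne hxy (s := p + L - t)
      (t := p + L - s) hL hLn hLe (by omega) (by omega) (fun k hk => ?_) ?_ ?_ (fun k hk => ?_)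
      (fun k hk hk' => ?_) ?_ ?_
    · rw [hits_comp_sub (by omega), hyL _ (by omega) (by omega)]; omega
    · rw [hits_comp_sub (by omega)]; rwa [show p + L - (p + L - t) = t by omega]
    · rw [hits_comp_sub (by omega)]; rwa [show p + L - (p + L - s) = s by omega]
    · rw [hits_comp_sub (by omega)]; exact hxt' _ (by omega) (by omega)
    · rw [hits_comp_sub (by omega)]; exact hxs' _ (by omega) (by omega)
    · rw [Nat.even_iff] at *; omega
    · rw [Nat.even_iff] at *; omega

end IsShortestOddHoleJP

section Counting

open scoped Classical in
/-- The number of `k < m` with `E k`. -/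
noncomputable def countBelow (E : ℕ → Prop) (m : ℕ) : ℕ := Nat.count E m

lemma countBelow_succ_of_pos {E : ℕ → Prop} {m : ℕ} (h : E m) :
    countBelow E (m + 1) = countBelow E m + 1 := by
  simp [countBelow, Nat.count_succ, h]

lemma countBelow_succ_of_neg {E : ℕ → Prop} {m : ℕ} (h : ¬ E m) :
    countBelow E (m + 1) = countBelow E m := by
  simp [countBelow, Nat.count_succ, h]

lemma countBelow_eq_of_forall_not {E : ℕ → Prop} {a b : ℕ} (hab : a ≤ b)
    (h : ∀ k, a ≤ k → k < b → ¬ E k) : countBelow E b = countBelow E a := by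
  induction b, hab using Nat.le_induction with
  | base => rfl
  | succ b hab ih =>
    rw [countBelow_succ_of_neg (h b hab (by omega)), ih fun k hk hk' => h k hk (by omega)]

lemma countBelow_add_of_periodic {E : ℕ → Prop} {n : ℕ} (hE : ∀ k, E (k + n) ↔ E k) (p : ℕ) :
    countBelow E (p + n) = countBelow E p + countBelow E n := by
  induction p with
  | zero => simp [countBelow]
  | succ p ih =>
    rw [show p + 1 + n = p + n + 1 by omega]
    by_cases h : E p
    · rw [countBelow_succ_of_pos h, countBelow_succ_of_pos ((hE p).2 h), ih]
      omega
    · rw [countBelow_succ_of_neg h, countBelow_succ_of_neg (mt (hE p).1 h), ih]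

/-- A function that does not change between consecutive points of `M` is constant on `M`. -/
lemma eq_on_marks {α : Type*} {M : ℕ → Prop} {g : ℕ → α}
    (h : ∀ m m', m < m' → M m → M m' → (∀ k, m < k → k < m' → ¬ M k) → g m' = g m) :
    ∀ m m', M m → M m' → g m' = g m := by
  have aux : ∀ d m m', m' - m ≤ d → m ≤ m' → M m → M m' → g m' = g m := by
    intro d
    induction d with
    | zero =>
      intro m m' hd hm _ _
      rw [show m' = m by omega]
    | succ d ih =>
      intro m m' hd hm hM hM'
      rcases hm.eq_or_lt with rfl | hlt
      · rfl
      by_cases hcon : ∀ k, m < k → k < m' → ¬ M k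
      · exact h m m' hlt hM hM' hcon
      · push Not at hcon
        obtain ⟨k, hk, hk', hMk⟩ := hcon
        exact (ih k m' (by omega) (by omega) hMk hM').trans (ih m k (by omega) (by omega) hM hMk)
  intro m m' hM hM'
  rcases le_total m m' with h | h
  · exact aux _ m m' le_rfl h hM hM'
  · exact (aux _ m' m le_rfl h hM' hM).symm

/-- If points of `M` at odd distance with no point of `M` in between always form an edge in `E`,
then the number of edges between two points of `M` has the parity of their distance. -/
lemma add_count_eq_on_marks {M E : ℕ → Prop} (hE : ∀ k, E k → M k ∧ M (k + 1))
    (hgap : ∀ m m', m < m' → M m → M m' → (∀ k, m < k → k < m' → ¬ M k) →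
      E m ∨ Even (m' - m)) (m m' : ℕ) (hm : M m) (hm' : M m') :
    ((m' + countBelow E m' : ℕ) : ZMod 2) = ((m + countBelow E m : ℕ) : ZMod 2) := by
  refine eq_on_marks (M := M) (g := fun m => ((m + countBelow E m : ℕ) : ZMod 2)) ?_ m m' hm hm'
  intro m m' hlt hm hm' hbet
  rw [ZMod.natCast_eq_natCast_iff']
  by_cases hEm : E m
  · obtain rfl : m' = m + 1 := by
      by_contra hne
      exact hbet (m + 1) (by omega) (by omega) (hE m hEm).2
    rw [countBelow_succ_of_pos hEm]
    omega
  · have hev := (hgap m m' hlt hm hm' hbet).resolve_left hEm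
    rw [Nat.even_iff] at hev
    rw [countBelow_eq_of_forall_not hlt.le fun k hk hk' hEk => ?_]
    · omega
    · rcases hk.eq_or_lt with rfl | hk
      · exact hEm hEk
      · exact hbet k hk hk' (hE k hEk).1

lemma count_odd_of_add_count_eq {M E : ℕ → Prop} {n : ℕ} (hn : Odd n)
    (hE : ∀ k, E (k + n) ↔ E k) (hM : ∀ k, M (k + n) ↔ M k) (hne : ∃ k, M k)
    (h : ∀ m m', M m → M m' →
      ((m' + countBelow E m' : ℕ) : ZMod 2) = ((m + countBelow E m : ℕ) : ZMod 2)) :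
    Odd (countBelow E n) := by
  obtain ⟨k, hk⟩ := hne
  have := h k (k + n) hk ((hM k).2 hk)
  rw [countBelow_add_of_periodic hE, ZMod.natCast_eq_natCast_iff'] at this
  rw [Nat.odd_iff] at *
  omega

end Counting

namespace IsShortestOddHoleJP

variable {G : SimpleGraph V} {n : ℕ} {f : ZMod n → V} {x y : V}

lemma add_count_eq (H : IsShortestOddHoleJP G n f) (hx : IsCMajor G f x) (m m' : ℕ)
    (hm : Hits G f x m) (hm' : Hits G f x m') :
    ((m' + countBelow (fun k => Hits G f x k ∧ Hits G f x (k + 1)) m' : ℕ) : ZMod 2) =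
      ((m + countBelow (fun k => Hits G f x k ∧ Hits G f x (k + 1)) m : ℕ) : ZMod 2) := by
  refine add_count_eq_on_marks (M := Hits G f x)
    (E := fun k => Hits G f x k ∧ Hits G f x (k + 1)) (fun k hk => hk) ?_ m m' hm hm'
  intro m m' hlt hm hm' hbet
  by_cases h1 : m' = m + 1
  · subst h1; exact Or.inl ⟨hm, hm'⟩
  · refine Or.inr (H.even_gap hx (p := m) (by omega) hm ?_ fun k hk hk' => ?_).2
    · rwa [show m + (m' - m) = m' by omega]
    · exact hbet k hk (by omega)

lemma exists_hits (H : IsShortestOddHoleJP G n f) (hx : IsCMajor G f x) :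
    ∃ k, Hits G f x k := by
  obtain ⟨k, -, -, h⟩ := H.exists_hits_four hx 0
  exact ⟨k, h⟩

lemma hits_add_length_add_one (k : ℕ) : Hits G f x (k + n + 1) ↔ Hits G f x (k + 1) := by
  rw [show k + n + 1 = k + 1 + n by omega, hits_add_length]

/-- Between two neighbours of `y`, the number of `x`-edges and the number of `{x, y}`-edges have
the same parity. -/
lemma count_add_count_eq (H : IsShortestOddHoleJP G n f) (hx : IsCMajor G f x)
    (hy : IsCMajor G f y) (hne : x ≠ y) (hxy : ¬ G.Adj x y) (m m' : ℕ)
    (hm : Hits G f y m) (hm' : Hits G f y m') :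
    ((countBelow (fun k => Hits G f x k ∧ Hits G f x (k + 1)) m' +
      countBelow (fun k => (Hits G f x k ∧ Hits G f x (k + 1)) ∧
        (Hits G f y k ∧ Hits G f y (k + 1))) m' : ℕ) : ZMod 2) =
    ((countBelow (fun k => Hits G f x k ∧ Hits G f x (k + 1)) m +
      countBelow (fun k => (Hits G f x k ∧ Hits G f x (k + 1)) ∧
        (Hits G f y k ∧ Hits G f y (k + 1))) m : ℕ) : ZMod 2) := by
  classical
  refine eq_on_marks (M := Hits G f y) (g := fun m =>
    ((countBelow (fun k => Hits G f x k ∧ Hits G f x (k + 1)) m +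
      countBelow (fun k => (Hits G f x k ∧ Hits G f x (k + 1)) ∧
        (Hits G f y k ∧ Hits G f y (k + 1))) m : ℕ) : ZMod 2)) ?_ m m' hm hm'
  intro m m' hlt hm hm' hbet
  rw [ZMod.natCast_eq_natCast_iff']
  by_cases h1 : m' = m + 1
  · subst h1
    by_cases hxm : Hits G f x m ∧ Hits G f x (m + 1)
    · rw [countBelow_succ_of_pos (E := fun k => Hits G f x k ∧ Hits G f x (k + 1)) hxm,
        countBelow_succ_of_pos (E := fun k => (Hits G f x k ∧ Hits G f x (k + 1)) ∧
          (Hits G f y k ∧ Hits G f y (k + 1))) ⟨hxm, hm, hm'⟩]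
      omega
    · rw [countBelow_succ_of_neg (E := fun k => Hits G f x k ∧ Hits G f x (k + 1)) hxm,
        countBelow_succ_of_neg (E := fun k => (Hits G f x k ∧ Hits G f x (k + 1)) ∧
          (Hits G f y k ∧ Hits G f y (k + 1))) fun h => hxm h.1]
  · rw [countBelow_eq_of_forall_not (E := fun k => (Hits G f x k ∧ Hits G f x (k + 1)) ∧
      (Hits G f y k ∧ Hits G f y (k + 1))) hlt.le fun k hk hk' hEk => ?_]
    swap
    · rcases hk.eq_or_lt with rfl | hk
      · exact hbet (m + 1) (by omega) (by omega) hEk.2.2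
      · exact hbet k hk hk' hEk.2.1
    by_cases hex : ∃ k, m ≤ k ∧ k ≤ m' ∧ Hits G f x k
    · obtain ⟨s, ⟨hs₁, hs₂, hs₃⟩, hs⟩ : ∃ s, (m ≤ s ∧ s ≤ m' ∧ Hits G f x s) ∧
          ∀ k < s, ¬ (m ≤ k ∧ k ≤ m' ∧ Hits G f x k) :=
        ⟨Nat.find hex, Nat.find_spec hex, fun k hk => Nat.find_min hex hk⟩
      have hex' : ∃ j, j ≤ m' ∧ m ≤ m' - j ∧ Hits G f x (m' - j) :=
        ⟨m' - s, by omega, by omega, by rwa [show m' - (m' - s) = s by omega]⟩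
      obtain ⟨j, ⟨hj₁, hj₂, hj₃⟩, hj⟩ : ∃ j, (j ≤ m' ∧ m ≤ m' - j ∧ Hits G f x (m' - j)) ∧
          ∀ k < j, ¬ (k ≤ m' ∧ m ≤ m' - k ∧ Hits G f x (m' - k)) :=
        ⟨Nat.find hex', Nat.find_spec hex', fun k hk => Nat.find_min hex' hk⟩
      have hst : s ≤ m' - j := by
        by_contra hlt'
        exact hs (m' - j) (by omega) ⟨hj₂, by omega, hj₃⟩
      have hlast : ∀ k, m' - j < k → k ≤ m' → ¬ Hits G f x k := fun k hk hk' h =>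
        hj (m' - k) (by omega) ⟨by omega, by omega, by rwa [show m' - (m' - k) = k by omega]⟩
      have hev := H.even_span hx hy hne hxy (p := m) (L := m' - m) (s := s) (t := m' - j)
        (by omega) hm (by rwa [show m + (m' - m) = m' by omega])
        (fun k hk hk' => hbet k hk (by omega)) hs₁ hst (by omega) hs₃ hj₃
        (fun k hk hk' h => hs k hk' ⟨hk, by omega, h⟩)
        (fun k hk hk' => hlast k hk (by omega))
      have hpar := H.add_count_eq hx s (m' - j) hs₃ hj₃
      have c₁ := countBelow_eq_of_forall_not (E := fun k => Hits G f x k ∧ Hits G f x (k + 1))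
        hs₁ fun k hk hk' hEk => hs k hk' ⟨hk, by omega, hEk.1⟩
      have c₂ := countBelow_eq_of_forall_not (E := fun k => Hits G f x k ∧ Hits G f x (k + 1))
        (show m' - j ≤ m' by omega)
        fun k hk hk' hEk => hlast (k + 1) (by omega) (by omega) hEk.2
      rw [ZMod.natCast_eq_natCast_iff'] at hpar
      rw [Nat.even_iff] at hev
      omega
    · rw [countBelow_eq_of_forall_not (E := fun k => Hits G f x k ∧ Hits G f x (k + 1)) hlt.le
        fun k hk hk' hEk => hex ⟨k, hk, hk'.le, hEk.1⟩]

lemma exists_common_hit (H : IsShortestOddHoleJP G n f) (hx : IsCMajor G f x)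
    (hy : IsCMajor G f y) (hne : x ≠ y) (hxy : ¬ G.Adj x y) :
    ∃ k, Hits G f x k ∧ Hits G f y k := by
  by_contra hcon
  have hodd := count_odd_of_add_count_eq (M := Hits G f x)
    (E := fun k => Hits G f x k ∧ Hits G f x (k + 1)) H.odd
    (fun k => by rw [hits_add_length, hits_add_length_add_one]) hits_add_length
    (H.exists_hits hx) (H.add_count_eq hx)
  obtain ⟨m, hm⟩ := H.exists_hits hy
  have := H.count_add_count_eq hx hy hne hxy m (m + n) hm ((hits_add_length m).2 hm)
  rw [countBelow_add_of_periodic (E := fun k => Hits G f x k ∧ Hits G f x (k + 1))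
      (fun k => by rw [hits_add_length, hits_add_length_add_one]),
    countBelow_eq_of_forall_not (E := fun k => (Hits G f x k ∧ Hits G f x (k + 1)) ∧
        (Hits G f y k ∧ Hits G f y (k + 1))) (Nat.le_add_right m n)
      (fun k _ _ hEk => hcon ⟨k, hEk.1.1, hEk.2.1⟩), ZMod.natCast_eq_natCast_iff'] at this
  rw [Nat.odd_iff] at hodd
  omega

/-- A minimal interval from a neighbour of `x` to a neighbour of `y` has even length. -/
lemma even_segment (H : IsShortestOddHoleJP G n f) (hx : IsCMajor G f x)
    (hy : IsCMajor G f y) (hne : x ≠ y) (hxy : ¬ G.Adj x y) {a b : ℕ} (hab : a ≤ b)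
    (ha : Hits G f x a) (hb : Hits G f y b) (hxab : ∀ k, a < k → k ≤ b → ¬ Hits G f x k)
    (hyab : ∀ k, a ≤ k → k < b → ¬ Hits G f y k) : Even (b - a) := by
  obtain ⟨p, hxp, hyp⟩ := H.exists_common_hit hx hy hne hxy
  have e₁ := H.add_count_eq hx p a hxp ha
  have e₂ := H.add_count_eq hy p b hyp hb
  have e₃ := H.count_add_count_eq hx hy hne hxy p b hyp hb
  have e₄ := H.count_add_count_eq hy hx hne.symm (fun h => hxy h.symm) p a hxp ha
  simp only [and_comm (a := Hits G f y _ ∧ Hits G f y _)] at e₄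
  have c₁ := countBelow_eq_of_forall_not (E := fun k => Hits G f x k ∧ Hits G f x (k + 1))
    hab fun k hk hk' hEk => hxab (k + 1) (by omega) (by omega) hEk.2
  have c₂ := countBelow_eq_of_forall_not (E := fun k => Hits G f y k ∧ Hits G f y (k + 1))
    hab fun k hk hk' hEk => hyab k hk hk' hEk.1
  have c₃ := countBelow_eq_of_forall_not (E := fun k => (Hits G f x k ∧ Hits G f x (k + 1)) ∧
      (Hits G f y k ∧ Hits G f y (k + 1)))
    hab fun k hk hk' hEk => hyab k hk hk' hEk.2.1
  rw [ZMod.natCast_eq_natCast_iff'] at e₁ e₂ e₃ e₄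
  rw [Nat.even_iff]
  omega

/-- For a nonempty stable set of major vertices, the number of edges of the hole with both ends
adjacent to a common member of the set is odd. -/
lemma odd_count_union (H : IsShortestOddHoleJP G n f) {S : Finset V} (hS : S.Nonempty)
    (hmaj : ∀ s ∈ S, IsCMajor G f s) (hstab : ∀ s ∈ S, ∀ t ∈ S, ¬ G.Adj s t) :
    Odd (countBelow (fun k => ∃ s ∈ S, Hits G f s k ∧ Hits G f s (k + 1)) n) := by
  refine count_odd_of_add_count_eq (M := fun k => ∃ s ∈ S, Hits G f s k)
    (E := fun k => ∃ s ∈ S, Hits G f s k ∧ Hits G f s (k + 1)) H.odd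
    (fun k => by simp only [hits_add_length, hits_add_length_add_one])
    (fun k => by simp only [hits_add_length]) ?_ (add_count_eq_on_marks ?_ ?_)
  · obtain ⟨s, hs⟩ := hS
    obtain ⟨k, hk⟩ := H.exists_hits (hmaj s hs)
    exact ⟨k, s, hs, hk⟩
  · rintro k ⟨s, hs, h₁, h₂⟩
    exact ⟨⟨s, hs, h₁⟩, ⟨s, hs, h₂⟩⟩
  · rintro m m' hlt ⟨s, hs, hsm⟩ ⟨t, ht, htm⟩ hbet
    have common : ∀ r ∈ S, Hits G f r m → Hits G f r m' →
        (∃ s ∈ S, Hits G f s m ∧ Hits G f s (m + 1)) ∨ Even (m' - m) := by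
      intro r hr h₁ h₂
      by_cases h : m' = m + 1
      · subst h; exact Or.inl ⟨r, hr, h₁, h₂⟩
      · refine Or.inr (H.even_gap (hmaj r hr) (p := m) (by omega) h₁ ?_ fun k hk hk' h => ?_).2
        · rwa [show m + (m' - m) = m' by omega]
        · exact hbet k hk (by omega) ⟨r, hr, h⟩
    by_cases hsm' : Hits G f s m'
    · exact common s hs hsm hsm'
    by_cases htm' : Hits G f t m
    · exact common t ht htm' htm
    refine Or.inr (H.even_segment (hmaj s hs) (hmaj t ht) (fun h => hsm' (h ▸ htm))
      (hstab s hs t ht) hlt.le hsm htm (fun k hk hk' h => ?_) (fun k hk hk' h => ?_))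
    · rcases hk'.eq_or_lt with rfl | hk'
      · exact hsm' h
      · exact hbet k hk hk' ⟨s, hs, h⟩
    · rcases hk.eq_or_lt with rfl | hk
      · exact htm' h
      · exact hbet k hk hk' ⟨t, ht, h⟩

/-- Some edge of the hole is complete to a given nonempty stable set of major vertices. -/
lemma exists_complete_edge (H : IsShortestOddHoleJP G n f) {S : Finset V} (hS : S.Nonempty)
    (hmaj : ∀ s ∈ S, IsCMajor G f s) (hstab : ∀ s ∈ S, ∀ t ∈ S, ¬ G.Adj s t) :
    ∃ k < n, ∀ s ∈ S, Hits G f s k ∧ Hits G f s (k + 1) := by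
  classical
  by_contra! hcon
  let E : Finset V → ℕ → Prop := fun T k => ∃ s ∈ T, Hits G f s k ∧ Hits G f s (k + 1)
  have hcount : ∀ T, ((countBelow (E T) n : ℕ) : ZMod 2) =
      ∑ k ∈ Finset.range n, if E T k then (1 : ZMod 2) else 0 := by
    intro T
    rw [countBelow, Nat.count_eq_card_filter_range, Finset.card_filter]
    push_cast
    exact Finset.sum_congr rfl fun k _ => by congr
  have hzero : ∑ T ∈ S.powerset, ((countBelow (E T) n : ℕ) : ZMod 2) = 0 := by
    simp only [hcount]
    rw [Finset.sum_comm]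
    refine Finset.sum_eq_zero fun k hk => ?_
    obtain ⟨s, hs, hsk⟩ := hcon k (Finset.mem_range.1 hk)
    rw [← Finset.insert_erase hs, Finset.sum_powerset_insert (Finset.notMem_erase s S)]
    have hE : ∀ T, E (insert s T) k ↔ E T k := by
      intro T
      constructor
      · rintro ⟨t, ht, h₁, h₂⟩
        rcases Finset.mem_insert.1 ht with rfl | ht
        · exact absurd h₂ (hsk h₁)
        · exact ⟨t, ht, h₁, h₂⟩
      · rintro ⟨t, ht, h⟩
        exact ⟨t, Finset.mem_insert_of_mem ht, h⟩
    simp only [hE]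
    exact CharTwo.add_self_eq_zero _
  have hone : ∀ T ∈ S.powerset.erase ∅, ((countBelow (E T) n : ℕ) : ZMod 2) = 1 := by
    intro T hT
    rw [Finset.mem_erase, Finset.mem_powerset] at hT
    have := H.odd_count_union (Finset.nonempty_iff_ne_empty.2 hT.1)
      (fun s hs => hmaj s (hT.2 hs)) (fun s hs t ht => hstab s (hT.2 hs) t (hT.2 ht))
    exact ZMod.natCast_eq_one_iff_odd.2 this
  have hempty : countBelow (E ∅) n = 0 := by
    simp [E, countBelow, Nat.count_eq_card_filter_range]
  rw [← Finset.add_sum_erase _ _ (Finset.empty_mem_powerset S), hempty, Finset.sum_congr rfl hone,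
    Finset.sum_const, Finset.card_erase_of_mem (Finset.empty_mem_powerset S),
    Finset.card_powerset] at hzero
  have hpos := Finset.card_pos.2 hS
  obtain ⟨c, hc⟩ : ∃ c, S.card = c + 1 := ⟨S.card - 1, by omega⟩
  have h2 : 1 ≤ 2 ^ c := Nat.one_le_two_pow
  rw [hc, pow_succ] at hzero
  simp only [Nat.cast_zero, zero_add, nsmul_eq_mul, mul_one] at hzero
  rw [ZMod.natCast_eq_zero_iff_even, Nat.even_iff] at hzero
  omega

end IsShortestOddHoleJP

lemma exists_five_hole {G : SimpleGraph V} {a b c d e : V} (hab : G.Adj a b) (hbc : G.Adj b c)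
    (hcd : G.Adj c d) (hde : G.Adj d e) (hea : G.Adj e a) (hac : ¬ G.Adj a c)
    (had : ¬ G.Adj a d) (hbd : ¬ G.Adj b d) (hbe : ¬ G.Adj b e) (hce : ¬ G.Adj c e) :
    ∃ g : ZMod 5 → V, IsHole G 5 g := by
  refine IsHoleSeq.exists_isHole (v := consSeq a (consSeq b (consSeq c (consSeq d fun _ => e))))
    (by omega) fun i j hij hj => ?_
  have hac' : a ≠ c := fun h => had (h ▸ hcd)
  have had' : a ≠ d := fun h => hac (h ▸ hcd.symm)
  have hbd' : b ≠ d := fun h => hbe (h ▸ hde)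
  have hbe' : b ≠ e := fun h => hbd (h ▸ hde.symm)
  have hce' : c ≠ e := fun h => hac (h ▸ hea.symm)
  interval_cases j <;> interval_cases i <;>
    simp [consSeq, hab, hbc, hcd, hde, hea.symm, hac, had, hbd, hbe, hce, hab.ne, hbc.ne, hcd.ne,
      hde.ne, hea.ne.symm, hac', had', hbd', hbe', hce']

/-- Let `G` contain no jewel, no pyramid and no hole of length five,
let `C` be a shortest odd hole in `G`, and let `x` be a `C`-major vertex. Then there
is an edge `uv` of `C` such that `x` is adjacent to one of `u, v`, and every `C`-major
vertex nonadjacent to `x` is adjacent to one of `u, v`. -/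
theorem heavy_edge_for_major_vertex {V : Type*} [Fintype V] (G : SimpleGraph V)
    (hJ : ¬ ContainsJewel G) (hP : ¬ ContainsPyramid G)
    (h5 : ¬ ∃ g : ZMod 5 → V, IsHole G 5 g)
    (n : ℕ) (f : ZMod n → V) (hC : IsShortestOddHole G n f)
    (x : V) (hx : IsCMajor G f x) :
    ∃ i : ZMod n, (G.Adj x (f i) ∨ G.Adj x (f (i + 1))) ∧
      ∀ v : V, IsCMajor G f v → ¬ G.Adj v x →
        (G.Adj v (f i) ∨ G.Adj v (f (i + 1))) := by
  classical
  have H : IsShortestOddHoleJP G n f := ⟨hC, hJ, hP⟩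
  let P : Finset V → Prop := fun S =>
    x ∈ S ∧ (∀ s ∈ S, IsCMajor G f s) ∧ ∀ s ∈ S, ∀ t ∈ S, ¬ G.Adj s t
  let A : Finset V → Finset ℕ := fun S => (Finset.range n).filter fun k => ∀ s ∈ S, Hits G f s k
  -- a stable set of major vertices through `x` with as few common neighbours as possible
  obtain ⟨S, hS, hmin⟩ := Finset.exists_min_image (Finset.univ.filter P) (fun S => (A S).card)
    ⟨{x}, by simp [P, hx]⟩
  simp only [Finset.mem_filter, Finset.mem_univ, true_and] at hS hmin
  obtain ⟨hxS, hmaj, hstab⟩ := hS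
  obtain ⟨k, hkn, hk⟩ := H.exists_complete_edge ⟨x, hxS⟩ hmaj hstab
  have cast_succ : ∀ z, Hits G f z (k + 1) ↔ G.Adj z (f ((k : ZMod n) + 1)) := by simp [Hits]
  refine ⟨(k : ZMod n), Or.inl (hk x hxS).1, fun v hv hvx => ?_⟩
  by_contra! hmiss
  obtain ⟨hvk, hvk'⟩ := hmiss
  have hnbr : ∀ s ∈ S, G.Adj v s → ∀ d, Hits G f x d → Hits G f v d → Hits G f s d := by
    intro s hs hvs d hxd hvd
    by_contra hsd
    have key : ∀ c, (∀ t ∈ S, G.Adj t (f c)) → ¬ G.Adj v (f c) → G.Adj (f c) (f d) := by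
      intro c hc hvc
      by_contra hcd
      exact h5 (exists_five_hole (hc x hxS) (hc s hs).symm hvs.symm hvd hxd.symm
        (hstab x hxS s hs) (fun h => hvx h.symm) (fun h => hvc h.symm) hcd hsd)
    have h₁ := (H.isHole.2.2 _ _).1 (key k (fun t ht => (hk t ht).1) hvk)
    have h₂ := (H.isHole.2.2 _ _).1
      (key (k + 1) (fun t ht => (cast_succ t).1 (hk t ht).2) hvk')
    have hd : (d : ZMod n) ≠ k := fun h => hvk (by rw [← h]; exact hvd)
    have hd' : (d : ZMod n) ≠ k + 1 := fun h => hvk' (by rw [← h]; exact hvd)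
    have h₁' := h₁.resolve_left hd'
    have h₂' := h₂.resolve_right fun h => hd (add_right_cancel h).symm
    have h3 : ((3 : ℕ) : ZMod n) = 0 := by
      push_cast
      linear_combination -h₁' - h₂'
    have := Nat.le_of_dvd (by omega) ((ZMod.natCast_eq_zero_iff 3 n).1 h3)
    have := H.five_le
    omega
  let S' := insert v (S.filter fun s => ¬ G.Adj v s)
  have hxS' : x ∈ S' := Finset.mem_insert_of_mem (Finset.mem_filter.2 ⟨hxS, hvx⟩)
  have hS' : P S' := by
    refine ⟨hxS', fun s hs => ?_, fun s hs t ht hst => ?_⟩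
    · rcases Finset.mem_insert.1 hs with rfl | hs
      · exact hv
      · exact hmaj s (Finset.mem_filter.1 hs).1
    · rcases Finset.mem_insert.1 hs with rfl | hs <;> rcases Finset.mem_insert.1 ht with rfl | ht
      · exact G.irrefl hst
      · exact (Finset.mem_filter.1 ht).2 hst
      · exact (Finset.mem_filter.1 hs).2 hst.symm
      · exact hstab s (Finset.mem_filter.1 hs).1 t (Finset.mem_filter.1 ht).1 hst
  have hss : A S' ⊂ A S := by
    refine (Finset.ssubset_iff_of_subset fun d hd => ?_).2 ⟨k, ?_, ?_⟩
    · rw [Finset.mem_filter] at hd ⊢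
      refine ⟨hd.1, fun s hs => ?_⟩
      by_cases hvs : G.Adj v s
      · exact hnbr s hs hvs d (hd.2 x hxS') (hd.2 v (Finset.mem_insert_self _ _))
      · exact hd.2 s (Finset.mem_insert_of_mem (Finset.mem_filter.2 ⟨hs, hvs⟩))
    · exact Finset.mem_filter.2 ⟨Finset.mem_range.2 hkn, fun s hs => (hk s hs).1⟩
    · exact fun h => hvk ((Finset.mem_filter.1 h).2 v (Finset.mem_insert_self _ _))
  exact absurd (hmin S' hS') (not_le.2 (Finset.card_lt_card hss))
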